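/- The distributional Bellman operator is a √γ-contraction in the maximal Cramér distance (squared form): let S and A be finite nonempty types (states and actions), let γ ∈ (0,1), let r : S × A → ℝ be a reward function, let p : S × A → S → ℝ satisfy p(s,a)(s') ≥ 0 and ∑_{s'} p(s,a)(s') = 1, and let π : S → A → ℝ satisfy π(s')(a') ≥ 0 and ∑_{a'} π(s')(a') = 1. For a value distribution μ : S × A → (Borel probability measures on ℝ), define the distributional Bellman operator (T^π μ)(s,a) = ∑_{s' ∈ S} ∑_{a' ∈ A} p(s,a)(s') · π(s')(a') · ((x ↦ r(s,a) + γx)_* μ(s',a')), a finite mixture of pushforward measures. Then for all value distributions μ, ν: max_{(s,a)} ℓ₂²((T^π μ)(s,a), (T^π ν)(s,a)) ≤ γ · max_{(s,a)} ℓ₂²(μ(s,a), ν(s,a)). -/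

import Mathlib

open MeasureTheory

/-- Cumulative distribution function of a Borel measure on ℝ. -/
noncomputable def cdf (P : Measure ℝ) (x : ℝ) : ℝ := (P (Set.Iic x)).toReal

/-- Squared Cramér distance, valued in `[0,∞]`. -/
noncomputable def cramerSq (P Q : Measure ℝ) : ENNReal :=
  ∫⁻ x, ENNReal.ofReal ((cdf P x - cdf Q x) ^ 2)

/-- Cramér distance, valued in `[0,∞]`. -/
noncomputable def cramer (P Q : Measure ℝ) : ENNReal :=
  cramerSq P Q ^ (1 / 2 : ℝ)

lemma cdf_mono (P : Measure ℝ) [IsFiniteMeasure P] : Monotone (cdf P) := fun _ _ h =>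
  ENNReal.toReal_mono (measure_ne_top _ _) (measure_mono (Set.Iic_subset_Iic.2 h))

lemma measurable_ofReal_cdf_sub_sq (P Q : Measure ℝ) [IsFiniteMeasure P] [IsFiniteMeasure Q] :
    Measurable fun x => ENNReal.ofReal ((cdf P x - cdf Q x) ^ 2) :=
  (((cdf_mono P).measurable.sub (cdf_mono Q).measurable).pow_const 2).ennreal_ofReal

lemma cdf_sum_smul {ι : Type*} (s : Finset ι) (w : ι → ℝ) (hw : ∀ i ∈ s, 0 ≤ w i)
    (P : ι → Measure ℝ) [∀ i, IsFiniteMeasure (P i)] (x : ℝ) :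
    cdf (∑ i ∈ s, ENNReal.ofReal (w i) • P i) x = ∑ i ∈ s, w i * cdf (P i) x := by
  simp only [cdf, Measure.finsetSum_apply, Measure.smul_apply, smul_eq_mul]
  rw [ENNReal.toReal_sum fun i _ => ENNReal.mul_ne_top ENNReal.ofReal_ne_top (measure_ne_top _ _)]
  refine Finset.sum_congr rfl fun i hi => ?_
  rw [ENNReal.toReal_mul, ENNReal.toReal_ofReal (hw i hi)]

/-- The squared Cramér distance is jointly convex. -/
lemma cramerSq_sum_smul_le {ι : Type*} (s : Finset ι) (w : ι → ℝ) (hw : ∀ i ∈ s, 0 ≤ w i)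
    (hw1 : ∑ i ∈ s, w i = 1) (P Q : ι → Measure ℝ)
    [∀ i, IsFiniteMeasure (P i)] [∀ i, IsFiniteMeasure (Q i)] :
    cramerSq (∑ i ∈ s, ENNReal.ofReal (w i) • P i) (∑ i ∈ s, ENNReal.ofReal (w i) • Q i) ≤
      ∑ i ∈ s, ENNReal.ofReal (w i) * cramerSq (P i) (Q i) := by
  simp only [cramerSq]
  simp_rw [← lintegral_const_mul _ (measurable_ofReal_cdf_sub_sq _ _)]
  rw [← lintegral_finsetSum _ fun i _ => (measurable_ofReal_cdf_sub_sq _ _).const_mul _]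
  refine lintegral_mono fun x => ?_
  have hsum : ∑ i ∈ s, ENNReal.ofReal (w i) * ENNReal.ofReal ((cdf (P i) x - cdf (Q i) x) ^ 2) =
      ENNReal.ofReal (∑ i ∈ s, w i * (cdf (P i) x - cdf (Q i) x) ^ 2) := by
    rw [ENNReal.ofReal_sum_of_nonneg fun i hi => mul_nonneg (hw i hi) (sq_nonneg _)]
    exact Finset.sum_congr rfl fun i hi => (ENNReal.ofReal_mul (hw i hi)).symm
  dsimp only
  rw [hsum, cdf_sum_smul s w hw, cdf_sum_smul s w hw, ← Finset.sum_sub_distrib]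
  simp_rw [← mul_sub]
  exact ENNReal.ofReal_le_ofReal
    (Real.pow_arith_mean_le_arith_mean_pow_of_even s w _ hw hw1 even_two)

lemma cdf_map_affine (P : Measure ℝ) {γ : ℝ} (hγ : 0 < γ) (r x : ℝ) :
    cdf (P.map fun y => r + γ * y) x = cdf P (γ⁻¹ * (x - r)) := by
  rw [cdf, cdf, Measure.map_apply (by fun_prop) measurableSet_Iic]
  congr 2
  ext y
  simp only [Set.mem_preimage, Set.mem_Iic]
  rw [le_inv_mul_iff₀ hγ, le_sub_iff_add_le']

lemma cramerSq_map_affine (P Q : Measure ℝ) [IsFiniteMeasure P] [IsFiniteMeasure Q]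
    {γ : ℝ} (hγ : 0 < γ) (r : ℝ) :
    cramerSq (P.map fun y => r + γ * y) (Q.map fun y => r + γ * y) =
      ENNReal.ofReal γ * cramerSq P Q := by
  simp only [cramerSq, cdf_map_affine _ hγ]
  rw [lintegral_sub_right_eq_self
      (fun x => ENNReal.ofReal ((cdf P (γ⁻¹ * x) - cdf Q (γ⁻¹ * x)) ^ 2)) r,
    ← lintegral_map (measurable_ofReal_cdf_sub_sq P Q) (measurable_const_mul γ⁻¹),
    Real.map_volume_mul_left (inv_ne_zero hγ.ne'), lintegral_smul_measure, inv_inv,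
    abs_of_pos hγ, smul_eq_mul]

/-- The distributional Bellman operator is a √γ-contraction in the maximal
Cramér distance (squared form). -/
theorem bellman_contraction {S A : Type*} [Fintype S] [Fintype A]
    [Nonempty S] [Nonempty A]
    (γ : ℝ) (hγ0 : 0 < γ) (hγ1 : γ < 1)
    (r : S × A → ℝ)
    (p : S × A → S → ℝ) (hp0 : ∀ sa s', 0 ≤ p sa s') (hp1 : ∀ sa, ∑ s', p sa s' = 1)
    (π : S → A → ℝ) (hπ0 : ∀ s' a', 0 ≤ π s' a') (hπ1 : ∀ s', ∑ a', π s' a' = 1)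
    (μ ν : S × A → Measure ℝ)
    [∀ sa, IsProbabilityMeasure (μ sa)] [∀ sa, IsProbabilityMeasure (ν sa)]
    (T : (S × A → Measure ℝ) → S × A → Measure ℝ)
    (hT : ∀ κ sa, T κ sa =
      ∑ s', ∑ a', ENNReal.ofReal (p sa s' * π s' a') •
        ((κ (s', a')).map (fun x => r sa + γ * x))) :
    (⨆ sa : S × A, cramerSq (T μ sa) (T ν sa))
      ≤ ENNReal.ofReal γ * ⨆ sa : S × A, cramerSq (μ sa) (ν sa) := by
  refine iSup_le fun sa => ?_
  have hw : ∀ i ∈ (Finset.univ : Finset (S × A)), 0 ≤ p sa i.1 * π i.1 i.2 :=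
    fun i _ => mul_nonneg (hp0 _ _) (hπ0 _ _)
  have hw1 : ∑ i : S × A, p sa i.1 * π i.1 i.2 = 1 := by
    simp [Fintype.sum_prod_type, ← Finset.mul_sum, hπ1, hp1]
  have hT' : ∀ κ, T κ sa = ∑ i : S × A, ENNReal.ofReal (p sa i.1 * π i.1 i.2) •
      (κ i).map (fun x => r sa + γ * x) := fun κ => by rw [hT, Fintype.sum_prod_type]
  rw [hT', hT']
  refine (cramerSq_sum_smul_le _ _ hw hw1 _ _).trans ?_
  calc ∑ i : S × A, ENNReal.ofReal (p sa i.1 * π i.1 i.2) *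
        cramerSq ((μ i).map fun x => r sa + γ * x) ((ν i).map fun x => r sa + γ * x)
      ≤ ∑ i : S × A, ENNReal.ofReal (p sa i.1 * π i.1 i.2) *
        (ENNReal.ofReal γ * ⨆ j, cramerSq (μ j) (ν j)) := by
        gcongr with i
        rw [cramerSq_map_affine _ _ hγ0]
        gcongr
        exact le_iSup (fun j => cramerSq (μ j) (ν j)) i
    _ = ENNReal.ofReal γ * ⨆ j, cramerSq (μ j) (ν j) := by
        rw [← Finset.sum_mul, ← ENNReal.ofReal_sum_of_nonneg hw, hw1, ENNReal.ofReal_one, one_mul]
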